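/- Let q be a complex number with |q| < 1. Then ∑_{n=0}^{∞} q^{n²+n} / (q; q)_n = (−q²; q²)_∞ · ∑_{n=0}^{∞} q^{n²+2n} / (q⁴; q⁴)_n, and ∑_{n=0}^{∞} q^{n²+n} / (q; q)_n = (−q; q²)_∞ · ∑_{n=0}^{∞} q^{n²+n} / ((q²; q²)_n · (−q; q²)_{n+1}). -/

import Mathlib

/-- The finite q-Pochhammer symbol `(a; q)_n = ∏_{j=0}^{n-1} (1 - a q^j)`. -/
noncomputable def qPoch (a q : ℂ) (n : ℕ) : ℂ := ∏ j ∈ Finset.range n, (1 - a * q ^ j)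

/-- The infinite q-Pochhammer symbol `(a; q)_∞ = ∏_{j=0}^{∞} (1 - a q^j)`. -/
noncomputable def qPochInf (a q : ℂ) : ℂ := ∏' j : ℕ, (1 - a * q ^ j)

theorem qPoch_succ (a q : ℂ) (n : ℕ) : qPoch a q (n + 1) = qPoch a q n * (1 - a * q ^ n) :=
  Finset.prod_range_succ _ _

theorem one_sub_norm_le_norm_one_sub_pow_succ {q : ℂ} (hq : ‖q‖ < 1) (n : ℕ) :
    1 - ‖q‖ ≤ ‖1 - q ^ (n + 1)‖ := by
  have h := norm_sub_norm_le (1 : ℂ) (q ^ (n + 1))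
  rw [norm_one, norm_pow] at h
  have : ‖q‖ ^ (n + 1) ≤ ‖q‖ := pow_le_of_le_one (norm_nonneg q) hq.le n.succ_ne_zero
  linarith

theorem one_sub_pow_succ_ne_zero {q : ℂ} (hq : ‖q‖ < 1) (n : ℕ) : 1 - q ^ (n + 1) ≠ 0 :=
  norm_pos_iff.1 ((sub_pos.2 hq).trans_le (one_sub_norm_le_norm_one_sub_pow_succ hq n))

theorem pow_one_sub_norm_le_norm_qPoch {q : ℂ} (hq : ‖q‖ < 1) (n : ℕ) :
    (1 - ‖q‖) ^ n ≤ ‖qPoch q q n‖ := by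
  induction n with
  | zero => simp [qPoch]
  | succ n ih =>
    rw [qPoch_succ, pow_succ, norm_mul, ← pow_succ']
    exact mul_le_mul ih (one_sub_norm_le_norm_one_sub_pow_succ hq n) (sub_nonneg.2 hq.le)
      (norm_nonneg _)

theorem qPoch_self_ne_zero {q : ℂ} (hq : ‖q‖ < 1) (n : ℕ) : qPoch q q n ≠ 0 :=
  norm_pos_iff.1 ((pow_pos (sub_pos.2 hq) n).trans_le (pow_one_sub_norm_le_norm_qPoch hq n))

theorem norm_inv_qPoch_le {q : ℂ} (hq : ‖q‖ < 1) (n : ℕ) :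
    ‖(qPoch q q n)⁻¹‖ ≤ (1 - ‖q‖)⁻¹ ^ n := by
  rw [norm_inv, inv_pow]
  exact inv_anti₀ (pow_pos (sub_pos.2 hq) n) (pow_one_sub_norm_le_norm_qPoch hq n)

theorem qPoch_sq_sq (a q : ℂ) (n : ℕ) :
    qPoch (a ^ 2) (q ^ 2) n = qPoch a q n * qPoch (-a) q n := by
  rw [qPoch, qPoch, qPoch, ← Finset.prod_mul_distrib]
  exact Finset.prod_congr rfl fun j _ => by ring

theorem summable_pow_choose_two_mul_pow {r : ℝ} (hr0 : 0 ≤ r) (hr : r < 1) (K : ℝ) :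
    Summable fun n : ℕ => r ^ n.choose 2 * K ^ n := by
  have ht : Filter.Tendsto (fun n : ℕ => r ^ n * |K|) Filter.atTop (nhds 0) := by
    simpa using (tendsto_pow_atTop_nhds_zero_of_lt_one hr0 hr).mul_const |K|
  refine summable_of_ratio_norm_eventually_le (r := 1 / 2) (by norm_num) ?_
  filter_upwards [ht.eventually_le_const (show (0 : ℝ) < 1 / 2 by norm_num)] with n hn
  have h : r ^ (n + 1).choose 2 * K ^ (n + 1) = (r ^ n * K) * (r ^ n.choose 2 * K ^ n) := by
    rw [Nat.choose_succ_succ' n 1, Nat.choose_one_right]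
    ring
  rw [h, norm_mul]
  refine mul_le_mul_of_nonneg_right ?_ (norm_nonneg _)
  rwa [norm_mul, Real.norm_of_nonneg (pow_nonneg hr0 n)]

theorem multipliable_one_sub_mul_pow (a : ℂ) {q : ℂ} (hq : ‖q‖ < 1) :
    Multipliable fun j : ℕ => 1 - a * q ^ j := by
  have h : Summable fun j : ℕ => ‖-(a * q ^ j)‖ := by
    simpa [norm_mul] using (summable_geometric_of_lt_one (norm_nonneg q) hq).mul_left ‖a‖
  simpa [sub_eq_add_neg] using multipliable_one_add_of_summable h

theorem tendsto_qPoch (a : ℂ) {q : ℂ} (hq : ‖q‖ < 1) :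
    Filter.Tendsto (qPoch a q) Filter.atTop (nhds (qPochInf a q)) :=
  (multipliable_one_sub_mul_pow a hq).hasProd.tendsto_prod_nat

theorem qPochInf_eq_qPoch_mul (a : ℂ) {q : ℂ} (hq : ‖q‖ < 1) (n : ℕ) :
    qPochInf a q = qPoch a q n * qPochInf (a * q ^ n) q := by
  have hterm (j : ℕ) : 1 - a * q ^ (j + n) = 1 - a * q ^ n * q ^ j := by ring
  have h := Multipliable.prod_mul_tprod_nat_mul' (f := fun j : ℕ => 1 - a * q ^ j) (k := n)
    (by simpa only [hterm] using multipliable_one_sub_mul_pow (a * q ^ n) hq)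
  simp only [hterm] at h
  exact h.symm

/-- The norm of the general term of Euler's series, bounded locally uniformly in `z`. -/
theorem norm_euler_term_le {q z : ℂ} {R : ℝ} (hq : ‖q‖ < 1) (hz : ‖z‖ ≤ R) (n : ℕ) :
    ‖q ^ n.choose 2 * z ^ n / qPoch q q n‖ ≤
      ‖q‖ ^ n.choose 2 * (R * (1 - ‖q‖)⁻¹) ^ n := by
  rw [div_eq_mul_inv, norm_mul, norm_mul, norm_pow, norm_pow, mul_pow, mul_assoc]
  have hR : 0 ≤ R := (norm_nonneg z).trans hz
  gcongr
  exact norm_inv_qPoch_le hq n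

theorem summable_euler (z : ℂ) {q : ℂ} (hq : ‖q‖ < 1) :
    Summable fun n : ℕ => q ^ n.choose 2 * z ^ n / qPoch q q n :=
  .of_norm_bounded (summable_pow_choose_two_mul_pow (norm_nonneg q) hq _)
    (norm_euler_term_le hq le_rfl)

theorem tsum_euler_eq_one_add_mul (z : ℂ) {q : ℂ} (hq : ‖q‖ < 1) :
    ∑' n : ℕ, q ^ n.choose 2 * z ^ n / qPoch q q n =
      (1 + z) * ∑' n : ℕ, q ^ n.choose 2 * (z * q) ^ n / qPoch q q n := by
  have hs := summable_euler (z * q) hq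
  have hs' := summable_euler z hq
  rw [add_mul, one_mul, hs'.tsum_eq_zero_add]
  nth_rw 1 [hs.tsum_eq_zero_add]
  rw [add_assoc, ← tsum_mul_left,
    ← ((summable_nat_add_iff 1).2 hs).tsum_add (hs.mul_left z)]
  congr 1
  refine tsum_congr fun n => ?_
  have h1 := qPoch_self_ne_zero hq n
  have h2 := one_sub_pow_succ_ne_zero hq n
  rw [qPoch_succ, ← pow_succ', Nat.choose_succ_succ' n 1, Nat.choose_one_right]
  field_simp
  ring

/-- Euler's expansion of `(-z; q)_∞` in powers of `z`. -/
theorem tsum_euler (z : ℂ) {q : ℂ} (hq : ‖q‖ < 1) :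
    ∑' n : ℕ, q ^ n.choose 2 * z ^ n / qPoch q q n = qPochInf (-z) q := by
  set f : ℂ → ℂ := fun w => ∑' n : ℕ, q ^ n.choose 2 * w ^ n / qPoch q q n with hf
  have hiter (k : ℕ) : f z = qPoch (-z) q k * f (z * q ^ k) := by
    induction k with
    | zero => simp [qPoch]
    | succ k ih =>
      rw [ih, qPoch_succ, show f (z * q ^ k) = _ from tsum_euler_eq_one_add_mul _ hq]
      simp only [hf, pow_succ]
      ring_nf
  have hz : Filter.Tendsto (fun k : ℕ => z * q ^ k) Filter.atTop (nhds 0) := by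
    simpa using (tendsto_pow_atTop_nhds_zero_of_norm_lt_one hq).const_mul z
  have hcont : Filter.Tendsto (fun k : ℕ => f (z * q ^ k)) Filter.atTop (nhds (f 0)) := by
    refine tendsto_tsum_of_dominated_convergence
      (summable_pow_choose_two_mul_pow (norm_nonneg q) hq (‖z‖ * (1 - ‖q‖)⁻¹))
      (fun n => ((hz.pow n).const_mul _).div_const _) (.of_forall fun k n => ?_)
    refine norm_euler_term_le hq ?_ n
    rw [norm_mul, norm_pow]
    exact mul_le_of_le_one_right (norm_nonneg z) (pow_le_one₀ (norm_nonneg q) hq.le)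
  have hf0 : f 0 = 1 := by
    simp only [hf]
    rw [tsum_eq_single 0 fun n hn => by simp [hn]]
    simp [qPoch]
  have hlim := (tendsto_qPoch (-z) hq).mul hcont
  simp only [← hiter, hf0, mul_one] at hlim
  exact tendsto_nhds_unique tendsto_const_nhds hlim

open PowerSeries in
theorem rescale_mk_inv_qPoch {q : ℂ} (hq : ‖q‖ < 1) :
    rescale q (mk fun n => (qPoch q q n)⁻¹) = (1 - X) * mk fun n => (qPoch q q n)⁻¹ := by
  ext n
  rw [sub_mul, one_mul, map_sub, coeff_rescale]
  cases n with
  | zero => simp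
  | succ n =>
    have h1 := qPoch_self_ne_zero hq n
    have h2 := one_sub_pow_succ_ne_zero hq n
    rw [coeff_succ_X_mul, coeff_mk, coeff_mk, qPoch_succ, ← pow_succ']
    field_simp
    ring

open PowerSeries in
theorem coeff_eq_inv_qPoch_of_rescale {q : ℂ} (hq : ‖q‖ < 1) {P : PowerSeries ℂ}
    (h0 : coeff 0 P = 1) (hP : rescale q P = (1 - X) * P) (n : ℕ) :
    coeff n P = (qPoch q q n)⁻¹ := by
  induction n with
  | zero => simpa [qPoch] using h0
  | succ n ih =>
    have h := congrArg (coeff (n + 1)) hP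
    rw [sub_mul, one_mul, map_sub, coeff_rescale, coeff_succ_X_mul, ih] at h
    have h2 := one_sub_pow_succ_ne_zero hq n
    rw [qPoch_succ, ← pow_succ', mul_inv, eq_mul_inv_iff_mul_eq₀ h2]
    linear_combination -h

theorem norm_sq_lt_one {q : ℂ} (hq : ‖q‖ < 1) : ‖q ^ 2‖ < 1 := by
  rw [norm_pow]
  exact pow_lt_one₀ (norm_nonneg q) hq two_ne_zero

open PowerSeries in
/-- The evaluation of the Rogers–Szegő polynomials in base `q²` at `q`. -/
theorem sum_antidiagonal_pow_div_qPoch {q : ℂ} (hq : ‖q‖ < 1) (N : ℕ) :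
    ∑ p ∈ Finset.HasAntidiagonal.antidiagonal N,
      q ^ p.2 / (qPoch (q ^ 2) (q ^ 2) p.1 * qPoch (q ^ 2) (q ^ 2) p.2) =
        (qPoch q q N)⁻¹ := by
  set A : PowerSeries ℂ := mk fun n => (qPoch (q ^ 2) (q ^ 2) n)⁻¹ with hA
  have hresc : rescale q (rescale q A) = (1 - X) * A := by
    rw [← rescale_mk_inv_qPoch (norm_sq_lt_one hq), rescale_rescale, ← sq]
  have h := coeff_eq_inv_qPoch_of_rescale hq (P := A * rescale q A)
    (by simp [coeff_mul, coeff_rescale, hA, qPoch, -coeff_zero_eq_constantCoeff])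
    (by rw [map_mul, hresc]; ring) N
  rw [← h, coeff_mul]
  refine Finset.sum_congr rfl fun p _ => ?_
  rw [coeff_rescale, hA, coeff_mk, coeff_mk]
  ring

theorem two_mul_choose_two_add (n : ℕ) : 2 * n.choose 2 + n = n ^ 2 := by
  induction n with
  | zero => rfl
  | succ n ih =>
    rw [Nat.choose_succ_succ' n 1, Nat.choose_one_right]
    linarith

/-- The general term of the double series to which all three single series reduce. -/
noncomputable def slaterTerm (q : ℂ) (p : ℕ × ℕ) : ℂ :=
  q ^ ((p.1 + p.2) ^ 2 + (p.1 + p.2) + p.2) /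
    (qPoch (q ^ 2) (q ^ 2) p.1 * qPoch (q ^ 2) (q ^ 2) p.2)

theorem summable_slaterTerm {q : ℂ} (hq : ‖q‖ < 1) : Summable (slaterTerm q) := by
  have hs := summable_pow_choose_two_mul_pow (norm_nonneg q) hq (1 - ‖q ^ 2‖)⁻¹
  have hpos : 0 < 1 - ‖q ^ 2‖ := sub_pos.2 (norm_sq_lt_one hq)
  refine .of_norm_bounded (hs.mul_of_nonneg hs (fun n => by positivity) fun n => by positivity) ?_
  rintro ⟨n, m⟩
  have hexp : n.choose 2 + m.choose 2 ≤ (n + m) ^ 2 + (n + m) + m := by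
    nlinarith [two_mul_choose_two_add n, two_mul_choose_two_add m]
  rw [slaterTerm, div_eq_mul_inv, mul_inv, norm_mul, norm_mul, norm_pow]
  calc _ ≤ ‖q‖ ^ (n.choose 2 + m.choose 2) *
        ((1 - ‖q ^ 2‖)⁻¹ ^ n * (1 - ‖q ^ 2‖)⁻¹ ^ m) := by
        gcongr ?_ * (?_ * ?_)
        · exact pow_le_pow_of_le_one (norm_nonneg q) hq.le hexp
        · exact norm_inv_qPoch_le (norm_sq_lt_one hq) n
        · exact norm_inv_qPoch_le (norm_sq_lt_one hq) m
    _ = _ := by ring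

theorem tsum_slaterTerm {q : ℂ} (hq : ‖q‖ < 1) :
    ∑' p, slaterTerm q p = ∑' n : ℕ, q ^ (n ^ 2 + n) / qPoch q q n := by
  have h := Finset.HasAntidiagonal.sigmaAntidiagonalEquivProd.hasSum_iff.2
    (summable_slaterTerm hq).hasSum
  refine (h.sigma fun N => hasSum_fintype _).tsum_eq.symm.trans (tsum_congr fun N => ?_)
  rw [div_eq_mul_inv, ← sum_antidiagonal_pow_div_qPoch hq, Finset.mul_sum,
    ← Finset.sum_coe_sort (Finset.HasAntidiagonal.antidiagonal N)]
  refine Finset.sum_congr rfl ?_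
  rintro ⟨⟨n, m⟩, hp⟩ -
  obtain rfl := Finset.HasAntidiagonal.mem_antidiagonal.1 hp
  simp only [Function.comp_apply, Finset.HasAntidiagonal.sigmaAntidiagonalEquivProd_apply,
    slaterTerm]
  ring

theorem tsum_slaterTerm_left {q : ℂ} (hq : ‖q‖ < 1) (n : ℕ) :
    ∑' m, slaterTerm q (m, n) =
      q ^ (n ^ 2 + 2 * n) / qPoch (q ^ 2) (q ^ 2) n *
        qPochInf (-q ^ (2 * n + 2)) (q ^ 2) := by
  rw [← tsum_euler _ (norm_sq_lt_one hq), ← tsum_mul_left]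
  refine tsum_congr fun m => ?_
  have hexp : (m + n) ^ 2 + (m + n) + n =
      n ^ 2 + 2 * n + 2 * m.choose 2 + (2 * n + 2) * m := by
    linarith [two_mul_choose_two_add m]
  rw [slaterTerm, hexp, pow_add, pow_add, pow_mul q 2 (m.choose 2), pow_mul q _ m]
  ring

theorem tsum_slaterTerm_right {q : ℂ} (hq : ‖q‖ < 1) (n : ℕ) :
    ∑' m, slaterTerm q (n, m) =
      q ^ (n ^ 2 + n) / qPoch (q ^ 2) (q ^ 2) n *
        qPochInf (-q ^ (2 * n + 3)) (q ^ 2) := by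
  rw [← tsum_euler _ (norm_sq_lt_one hq), ← tsum_mul_left]
  refine tsum_congr fun m => ?_
  have hexp : (n + m) ^ 2 + (n + m) + m =
      n ^ 2 + n + 2 * m.choose 2 + (2 * n + 3) * m := by
    linarith [two_mul_choose_two_add m]
  rw [slaterTerm, hexp, pow_add, pow_add, pow_mul q 2 (m.choose 2), pow_mul q _ m]
  ring

theorem qPoch_neg_pow_succ_ne_zero {q : ℂ} (hq : ‖q‖ < 1) (k n : ℕ) :
    qPoch (-q ^ (k + 1)) (q ^ 2) n ≠ 0 := by
  refine Finset.prod_ne_zero_iff.2 fun j _ h => ?_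
  have h1 : q ^ (k + 2 * j + 1) = -1 := by linear_combination h
  have h2 := congrArg norm h1
  rw [norm_pow, norm_neg, norm_one] at h2
  exact (pow_lt_one₀ (norm_nonneg q) hq (Nat.succ_ne_zero _)).ne h2

/-- equality of the left sides of S14, S16 and S94: for `|q| < 1`,
`∑_{n≥0} q^{n²+n}/(q; q)_n = (−q²; q²)_∞ ∑_{n≥0} q^{n²+2n}/(q⁴; q⁴)_n` and
`∑_{n≥0} q^{n²+n}/(q; q)_n
  = (−q; q²)_∞ ∑_{n≥0} q^{n²+n}/((q²; q²)_n (−q; q²)_{n+1})`. -/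
theorem slater_S14_S16_S94 (q : ℂ) (hq : ‖q‖ < 1) :
    (∑' n : ℕ, q ^ (n ^ 2 + n) / qPoch q q n =
      qPochInf (-q ^ 2) (q ^ 2) * ∑' n : ℕ, q ^ (n ^ 2 + 2 * n) / qPoch (q ^ 4) (q ^ 4) n) ∧
    (∑' n : ℕ, q ^ (n ^ 2 + n) / qPoch q q n =
      qPochInf (-q) (q ^ 2) *
        ∑' n : ℕ, q ^ (n ^ 2 + n) /
          (qPoch (q ^ 2) (q ^ 2) n * qPoch (-q) (q ^ 2) (n + 1))) := by
  constructor
  · rw [← tsum_slaterTerm hq, ← (Equiv.prodComm ℕ ℕ).tsum_eq, ← tsum_mul_left]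
    refine ((Equiv.prodComm ℕ ℕ).summable_iff.2 (summable_slaterTerm hq)).tsum_prod.trans ?_
    refine tsum_congr fun n => (tsum_slaterTerm_left hq n).trans ?_
    have h := qPoch_neg_pow_succ_ne_zero hq 1 n
    rw [qPochInf_eq_qPoch_mul (-q ^ 2) (norm_sq_lt_one hq) n,
      show -q ^ 2 * (q ^ 2) ^ n = -q ^ (2 * n + 2) by ring,
      show q ^ 4 = (q ^ 2) ^ 2 by ring, qPoch_sq_sq (q ^ 2)]
    field_simp
  · rw [← tsum_slaterTerm hq, ← tsum_mul_left, (summable_slaterTerm hq).tsum_prod]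
    refine tsum_congr fun n => (tsum_slaterTerm_right hq n).trans ?_
    have h : qPoch (-q) (q ^ 2) (n + 1) ≠ 0 := by
      simpa using qPoch_neg_pow_succ_ne_zero hq 0 (n + 1)
    rw [qPochInf_eq_qPoch_mul (-q) (norm_sq_lt_one hq) (n + 1),
      show -q * (q ^ 2) ^ (n + 1) = -q ^ (2 * n + 3) by ring]
    field_simp
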